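/- Let f₁,…,f_m ∈ ℤ[x] with d = max_i deg(f_i) ≥ 1 and h = max_i height(f_i), and suppose 1 belongs to the ideal generated by f₁,…,f_m in ℚ[x]. If {g₁,…,g_s} is a reduced Gröbner basis of the ideal of ℤ[x] generated by f₁,…,f_m, then height(g_j) ≤ d(2h + log(d+1)) for every j. -/

import Mathlib

open Polynomial

/-- The height of an integer polynomial: the natural logarithm of the maximum of the
absolute values of its coefficients (the height of 0 is 0, since `Real.log 0 = 0`). -/
noncomputable def polyHeight (f : Polynomial ℤ) : ℝ :=
  Real.log (((Finset.range (f.natDegree + 1)).sup fun k => (f.coeff k).natAbs : ℕ) : ℝ)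

/-- A finite set `G` of nonzero polynomials in ℤ[x] with positive leading coefficients
is a Gröbner basis of an ideal `I ⊆ ℤ[x]` if `G ⊆ I`, `G` generates `I`, and for
every nonzero `f ∈ I` there is a `g ∈ G` with `deg g ≤ deg f` and `lc g ∣ lc f`. -/
def IsGroebnerBasis (G : Finset (Polynomial ℤ)) (I : Ideal (Polynomial ℤ)) : Prop :=
  (∀ g ∈ G, g ≠ 0 ∧ 0 < g.leadingCoeff) ∧
  (↑G : Set (Polynomial ℤ)) ⊆ (I : Set (Polynomial ℤ)) ∧
  Ideal.span (↑G : Set (Polynomial ℤ)) = I ∧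
  ∀ f ∈ I, f ≠ 0 → ∃ g ∈ G, g.natDegree ≤ Polynomial.natDegree f ∧
    g.leadingCoeff ∣ f.leadingCoeff

/-- A Gröbner basis `G` is reduced if moreover for all `g ≠ g'` in `G` and every
`k ≥ deg g'`, the coefficient of `x^k` in `g` lies in `[0, lc g')`. -/
def IsReducedGroebnerBasis (G : Finset (Polynomial ℤ)) (I : Ideal (Polynomial ℤ)) : Prop :=
  IsGroebnerBasis G I ∧
  ∀ g ∈ G, ∀ g' ∈ G, g ≠ g' → ∀ k : ℕ, g'.natDegree ≤ k →
    0 ≤ g.coeff k ∧ g.coeff k < g'.leadingCoeff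

lemma hadamard_bd {N : ℕ} (M : Matrix (Fin N) (Fin N) ℝ) (B : ℝ) (hB : 0 ≤ B)
    (hM : ∀ i, ∑ k, (M i k)^2 ≤ B) : M.det ^ 2 ≤ B ^ N := by
  let b := EuclideanSpace.basisFun (Fin N) ℝ
  have : Fact (Module.finrank ℝ (EuclideanSpace ℝ (Fin N)) = N) := ⟨by simp⟩
  let v : Fin N → EuclideanSpace ℝ (Fin N) := fun i => WithLp.toLp 2 (M i)
  have h1 := b.toBasis.orientation.abs_volumeForm_apply_le v
  rw [b.toBasis.orientation.volumeForm_robust' b v] at h1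
  have h2 : b.toBasis.det v = M.det := by
    rw [Module.Basis.det_apply, ← Matrix.det_transpose]
    congr 1
  rw [h2] at h1
  have h3 : ∏ i, ‖v i‖ ≤ (Real.sqrt B) ^ N := by
    calc ∏ i, ‖v i‖ ≤ ∏ i : Fin N, Real.sqrt B := by
          apply Finset.prod_le_prod
          · intros; positivity
          · intro i _
            rw [EuclideanSpace.norm_eq]
            apply Real.sqrt_le_sqrt
            simpa [v] using hM i
      _ = _ := by simp
  have h4 := h1.trans h3
  calc M.det ^ 2 = |M.det| ^ 2 := (sq_abs _).symm
    _ ≤ ((Real.sqrt B) ^ N)^2 := by gcongr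
    _ = B ^ N := by rw [← pow_mul, mul_comm, pow_mul, Real.sq_sqrt hB]

/-- spanning -/
lemma span_rows {m n : ℕ} (F : Fin m → ℚ[X]) (i0 : Fin m) (hn : 1 ≤ n)
    (h0 : (F i0).natDegree = n) (hF : ∀ i, (F i).natDegree ≤ n)
    (h1 : (1 : ℚ[X]) ∈ Ideal.span (Set.range F)) :
    (⊤ : Submodule ℚ (Fin (2*n) → ℚ)) ≤ Submodule.span ℚ (Set.range
      fun (p : Fin m × Fin n) => fun k : Fin (2*n) => (X ^ (p.2 : ℕ) * F p.1).coeff k) := by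
  intro v _
  set S := Submodule.span ℚ (Set.range
      fun (p : Fin m × Fin n) => fun k : Fin (2*n) => (X ^ (p.2 : ℕ) * F p.1).coeff k) with hS
  let φ : ℚ[X] →ₗ[ℚ] (Fin (2*n) → ℚ) := LinearMap.pi fun k => lcoeff ℚ k
  have hne : F i0 ≠ 0 := by
    intro h; rw [h] at h0; simp at h0; omega
  have key : ∀ (r : ℚ[X]) (i : Fin m), r.natDegree < n → φ (r * F i) ∈ S := by
    intro r i hr
    rw [r.as_sum_range_C_mul_X_pow' hr, Finset.sum_mul, map_sum]
    refine Submodule.sum_mem _ fun j hj => ?_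
    rw [mul_assoc, ← smul_eq_C_mul, map_smul]
    refine Submodule.smul_mem _ _ (Submodule.subset_span ⟨(i, ⟨j, Finset.mem_range.1 hj⟩), ?_⟩)
    rfl
  let u : ℚ[X] := ∑ k : Fin (2*n), C (v k) * X ^ (k : ℕ)
  have hu : φ u = v := by
    ext k
    simp [φ, u, coeff_X_pow, Fin.val_inj]
  have hud : u.degree < (2*n : ℕ) := by
    refine (degree_sum_fin_lt v)
  have hmem : u ∈ Ideal.span (Set.range F) := by
    rw [(Ideal.eq_top_iff_one _).2 h1]; trivial
  obtain ⟨c, hc⟩ := Ideal.mem_span_range_iff_exists_fun.1 hmem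
  let b := ∑ i, (c i / F i0) * F i
  have hdec : u = ∑ i, (c i % F i0) * F i + b * F i0 := by
    rw [← hc, Finset.sum_mul, ← Finset.sum_add_distrib]
    refine Finset.sum_congr rfl fun i _ => ?_
    conv_lhs => rw [← EuclideanDomain.div_add_mod (c i) (F i0)]
    ring
  have hr : ∀ i, (c i % F i0).natDegree < n := by
    intro i
    have := natDegree_mod_lt (c i) (q := F i0) (by omega)
    omega
  have hb : b.natDegree < n := by
    by_cases hb0 : b = 0
    · rw [hb0]; simp; omega
    have e : b * F i0 = u - ∑ i, (c i % F i0) * F i := by rw [hdec]; ring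
    have d1 : (b * F i0).degree < (2*n : ℕ) := by
      rw [e]
      refine (degree_sub_le _ _).trans_lt (max_lt hud ?_)
      refine (degree_sum_le _ _).trans_lt ?_
      rw [Finset.sup_lt_iff (by exact WithBot.bot_lt_coe _)]
      intro i _
      refine degree_le_natDegree.trans_lt ?_
      have := natDegree_mul_le (p := c i % F i0) (q := F i)
      have := hr i
      have := hF i
      exact_mod_cast (by omega : ((c i % F i0) * F i).natDegree < 2 * n)
    have d2 : (b * F i0).natDegree < 2*n := (natDegree_lt_iff_degree_lt (mul_ne_zero hb0 hne)).2 d1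
    rw [natDegree_mul hb0 hne] at d2
    omega
  rw [← hu, hdec, map_add, map_sum]
  exact Submodule.add_mem _ (Submodule.sum_mem _ fun i _ => key _ _ (hr i)) (key _ _ hb)

lemma core {m n : ℕ} (f : Fin m → ℤ[X]) (i0 : Fin m) (hn : 1 ≤ n)
    (h0 : (f i0).natDegree = n) (hF : ∀ i, (f i).natDegree ≤ n)
    (H : ℝ) (hH0 : 0 ≤ H) (hH : ∀ i k, |((f i).coeff k : ℝ)| ≤ H)
    (h1 : (1 : ℚ[X]) ∈ Ideal.span (Set.range fun i => (f i).map (Int.castRingHom ℚ))) :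
    ∃ D : ℤ, D ≠ 0 ∧ C D ∈ Ideal.span (Set.range f) ∧
      |(D : ℝ)| ≤ (((n : ℝ) + 1) * H ^ 2) ^ n := by
  have hinj : Function.Injective (Int.castRingHom ℚ) := Int.cast_injective
  have hspan := span_rows (fun i => (f i).map (Int.castRingHom ℚ)) i0 hn
    (by simpa [natDegree_map_eq_of_injective hinj] using h0)
    (fun i => by simpa [natDegree_map_eq_of_injective hinj] using hF i) h1
  let w : Fin m × Fin n → (Fin (2*n) → ℚ) := fun p k =>
    (X ^ (p.2 : ℕ) * (f p.1).map (Int.castRingHom ℚ)).coeff k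
  change ⊤ ≤ Submodule.span ℚ (Set.range w) at hspan
  have htop := top_le_iff.1 hspan
  obtain ⟨κ, a, ha, hsp, hli⟩ := exists_linearIndependent' ℚ w
  rw [htop] at hsp
  let B := Module.Basis.mk hli hsp.ge
  let e : κ ≃ Fin (2*n) := B.indexEquiv (Pi.basisFun ℚ (Fin (2*n)))
  let σ : Fin (2*n) → Fin m × Fin n := a ∘ e.symm
  have hli2 : LinearIndependent ℚ (w ∘ σ) := by
    have := hli.comp e.symm e.symm.injective
    exact this
  let M : Matrix (Fin (2*n)) (Fin (2*n)) ℤ := fun r k =>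
    (X ^ ((σ r).2 : ℕ) * f (σ r).1).coeff k
  have hMw : (M.map (Int.castRingHom ℚ)) = w ∘ σ := by
    ext r k
    change (Int.castRingHom ℚ) ((X ^ ((σ r).2 : ℕ) * f (σ r).1).coeff k) =
      (X ^ ((σ r).2 : ℕ) * (f (σ r).1).map (Int.castRingHom ℚ)).coeff k
    rw [← coeff_map, Polynomial.map_mul, Polynomial.map_pow, map_X]
  have hdet : M.det ≠ 0 := by
    intro h
    have : IsUnit (M.map (Int.castRingHom ℚ)) := by
      rw [← Matrix.linearIndependent_rows_iff_isUnit]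
      rw [hMw]; exact hli2
    rw [Matrix.isUnit_iff_isUnit_det, ← RingHom.mapMatrix_apply, ← RingHom.map_det, h] at this
    simp at this
  have hpd : ∀ r, (X ^ ((σ r).2 : ℕ) * f (σ r).1).natDegree < 2 * n := by
    intro r
    have := natDegree_mul_le (p := (X : ℤ[X]) ^ ((σ r).2 : ℕ)) (q := f (σ r).1)
    rw [natDegree_X_pow] at this
    have := hF (σ r).1
    have := (σ r).2.isLt
    omega
  refine ⟨M.det, hdet, ?_, ?_⟩
  · let z : Fin (2*n) := ⟨0, by omega⟩
    have : C M.det = ∑ r, C (M.adjugate z r) * (X ^ ((σ r).2 : ℕ) * f (σ r).1) := by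
      ext k
      rw [finsetSum_coeff]
      simp only [coeff_C_mul]
      by_cases hk : k < 2 * n
      · have h := congrFun (congrFun M.adjugate_mul z) ⟨k, hk⟩
        rw [Matrix.mul_apply] at h
        change ∑ r, M.adjugate z r * (X ^ ((σ r).2 : ℕ) * f (σ r).1).coeff k = _ at h
        rw [h, coeff_C]
        simp [Matrix.one_apply, z, Fin.ext_iff, eq_comm]
      · rw [Finset.sum_eq_zero, coeff_C, if_neg (by omega)]
        intro r _
        rw [coeff_eq_zero_of_natDegree_lt (by have := hpd r; omega), mul_zero]
    rw [this]
    refine Ideal.sum_mem _ fun r _ => Ideal.mul_mem_left _ _ (Ideal.mul_mem_left _ _ ?_)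
    exact Ideal.subset_span ⟨_, rfl⟩
  · have hB : (0:ℝ) ≤ ((n : ℝ) + 1) * H ^ 2 := by positivity
    have := hadamard_bd (M.map (Int.castRingHom ℝ)) (((n : ℝ) + 1) * H ^ 2) hB ?_
    · rw [← RingHom.mapMatrix_apply, ← RingHom.map_det, pow_mul'] at this
      exact abs_le_of_sq_le_sq this (by positivity)
    · intro r
      let j : ℕ := (σ r).2
      have hc : ∀ k, (M r k : ℝ) ^ 2 ≤ if (k : ℕ) ∈ Finset.Icc j (j + n) then H ^ 2 else 0 := by
        intro k
        change (((X ^ j * f (σ r).1).coeff k : ℤ) : ℝ) ^ 2 ≤ _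
        rw [coeff_X_pow_mul']
        split_ifs with h1 h2 h2
        · rw [← sq_abs]
          gcongr
          exact hH _ _
        · rw [coeff_eq_zero_of_natDegree_lt]
          · simp
          · have := hF (σ r).1
            simp at h2; omega
        · simp; positivity
        · simp
      calc ∑ k, (M.map (Int.castRingHom ℝ) r k)^2 
          ≤ ∑ k : Fin (2*n), if (k : ℕ) ∈ Finset.Icc j (j + n) then H ^ 2 else 0 :=
            Finset.sum_le_sum fun k _ => hc k
        _ = ∑ k ∈ Finset.range (2*n), if k ∈ Finset.Icc j (j + n) then H ^ 2 else 0 :=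
            Fin.sum_univ_eq_sum_range (fun k => if k ∈ Finset.Icc j (j + n) then H ^ 2 else 0) _
        _ = ∑ k ∈ (Finset.range (2*n)).filter (· ∈ Finset.Icc j (j + n)), H ^ 2 := by
            rw [Finset.sum_filter]
        _ ≤ ∑ k ∈ Finset.Icc j (j + n), H ^ 2 := by
            apply Finset.sum_le_sum_of_subset_of_nonneg
            · intro k hk; exact (Finset.mem_filter.1 hk).2
            · intros; positivity
        _ = _ := by
            rw [Finset.sum_const, Nat.card_Icc, nsmul_eq_mul]
            congr 1
            rw [show j + n + 1 - j = n + 1 by omega]; push_cast; rfl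

lemma coeff_le_exp (f : ℤ[X]) (h : ℝ) (hf : polyHeight f ≤ h) (k : ℕ) :
    |(f.coeff k : ℝ)| ≤ Real.exp h := by
  by_cases hk : f.natDegree < k
  · rw [coeff_eq_zero_of_natDegree_lt hk]; simp; positivity
  unfold polyHeight at hf
  have hle : (f.coeff k).natAbs ≤
      (Finset.range (f.natDegree + 1)).sup fun k => (f.coeff k).natAbs :=
    Finset.le_sup (f := fun k => (f.coeff k).natAbs) (Finset.mem_range.2 (by omega))
  generalize (Finset.range (f.natDegree + 1)).sup (fun k => (f.coeff k).natAbs) = s at hf hle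
  have e : |(f.coeff k : ℝ)| = ((f.coeff k).natAbs : ℝ) := by
    rw [Nat.cast_natAbs]; simp
  rw [e]
  have hle' : ((f.coeff k).natAbs : ℝ) ≤ s := by exact_mod_cast hle
  refine hle'.trans ?_
  rcases Nat.eq_zero_or_pos s with rfl | hs
  · simp; positivity
  · rw [← Real.exp_log (show (0:ℝ) < s by exact_mod_cast hs)]
    exact Real.exp_le_exp.2 hf

lemma polyHeight_nonneg (f : ℤ[X]) : 0 ≤ polyHeight f := Real.log_natCast_nonneg _

lemma exists_small_const {m : ℕ} (f : Fin m → Polynomial ℤ)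
    (d : ℕ) (hd1 : 1 ≤ d) (hd : ∀ i, (f i).natDegree ≤ d)
    (h : ℝ) (hh : ∀ i, polyHeight (f i) ≤ h)
    (h1 : (1 : Polynomial ℚ) ∈
      Ideal.span (Set.range fun i => (f i).map (Int.castRingHom ℚ))) :
    ∃ D : ℤ, D ≠ 0 ∧ C D ∈ Ideal.span (Set.range f) ∧
      |(D : ℝ)| ≤ Real.exp ((d : ℝ) * (2 * h + Real.log ((d : ℝ) + 1))) := by
  have hex : ∃ i, f i ≠ 0 := by
    by_contra! hc
    have hle : Ideal.span (Set.range fun i => (f i).map (Int.castRingHom ℚ)) ≤ ⊥ := by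
      rw [Ideal.span_le]
      rintro _ ⟨i, rfl⟩
      simp [hc i]
    exact one_ne_zero ((Submodule.mem_bot _).1 (hle h1))
  obtain ⟨i1, hi1⟩ := hex
  have hh0 : 0 ≤ h := (polyHeight_nonneg (f i1)).trans (hh i1)
  have : Nonempty (Fin m) := ⟨i1⟩
  obtain ⟨i0, hi0⟩ := Finite.exists_max fun i => (f i).natDegree
  have hd1' : (1:ℝ) ≤ d := by exact_mod_cast hd1
  rcases Nat.eq_zero_or_pos (f i0).natDegree with hz | hpos
  · have hz1 : (f i1).natDegree = 0 := by have := hi0 i1; omega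
    have hC := eq_C_of_natDegree_eq_zero hz1
    refine ⟨(f i1).coeff 0, ?_, ?_, ?_⟩
    · intro h0
      rw [h0] at hC
      exact hi1 (by simpa using hC)
    · rw [← hC]; exact Ideal.subset_span ⟨i1, rfl⟩
    · refine (coeff_le_exp _ h (hh i1) 0).trans (Real.exp_le_exp.2 ?_)
      have hl : 0 ≤ Real.log ((d:ℝ) + 1) := Real.log_nonneg (by linarith)
      nlinarith
  · obtain ⟨D, hD, hm, hb⟩ := core f i0 hpos rfl hi0 (Real.exp h) (Real.exp_pos _).le
      (fun i k => coeff_le_exp _ h (hh i) k) h1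
    refine ⟨D, hD, hm, hb.trans ?_⟩
    have hnd : ((f i0).natDegree : ℝ) ≤ d := by exact_mod_cast hd i0
    generalize ((f i0).natDegree) = n at hnd
    have hn0 : (0:ℝ) ≤ n := Nat.cast_nonneg _
    have e : ((n:ℝ) + 1) * Real.exp h ^ 2 = Real.exp (2 * h + Real.log ((n:ℝ) + 1)) := by
      rw [Real.exp_add, Real.exp_log (by linarith), mul_comm, ← Real.exp_nat_mul]
      norm_num
    rw [e, ← Real.exp_nat_mul]
    apply Real.exp_le_exp.2
    have hl : 0 ≤ Real.log ((n:ℝ) + 1) := Real.log_nonneg (by linarith)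
    gcongr

/-- Let f₁,…,f_m ∈ ℤ[x] with d = max deg(f_i) ≥ 1 and h = max height(f_i),
and suppose 1 belongs to the ideal generated by the f_i in ℚ[x]. If {g₁,…,g_s} is a
reduced Gröbner basis of the ideal of ℤ[x] generated by f₁,…,f_m, then
height(g_j) ≤ d(2h + log(d+1)) for every j. -/
theorem stmt19 {m : ℕ} (f : Fin m → Polynomial ℤ)
    (d : ℕ) (hd1 : 1 ≤ d) (hd : ∀ i, (f i).natDegree ≤ d)
    (h : ℝ) (hh : ∀ i, polyHeight (f i) ≤ h)
    (h1 : (1 : Polynomial ℚ) ∈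
      Ideal.span (Set.range fun i => (f i).map (Int.castRingHom ℚ)))
    (G : Finset (Polynomial ℤ))
    (hG : IsReducedGroebnerBasis G (Ideal.span (Set.range f))) :
    ∀ g ∈ G, polyHeight g ≤ (d : ℝ) * (2 * h + Real.log ((d : ℝ) + 1)) := by
  intro g hg
  obtain ⟨D, hD, hm, hb⟩ := exists_small_const f d hd1 hd h hh h1
  obtain ⟨⟨hpos, -, -, hgb⟩, hred⟩ := hG
  obtain ⟨g0, hg0, hdeg, hdvd⟩ := hgb (C D) hm (by simpa using hD)
  rw [natDegree_C, Nat.le_zero] at hdeg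
  rw [leadingCoeff_C] at hdvd
  have hl0 := (hpos g0 hg0).2
  have hlD : g0.leadingCoeff ≤ |D| := Int.le_of_dvd (abs_pos.2 hD) ((dvd_abs _ _).2 hdvd)
  rw [Int.abs_eq_natAbs] at hlD
  have hco : ∀ k ≤ g.natDegree, (g.coeff k).natAbs ≤ D.natAbs := by
    intro k hk
    by_cases hgg : g = g0
    · subst hgg
      have hk0 : k = g.natDegree := by omega
      rw [hk0, coeff_natDegree]
      omega
    · have := hred g hg g0 hg0 hgg k (by omega)
      omega
  have hsup : ((Finset.range (g.natDegree + 1)).sup fun k => (g.coeff k).natAbs) ≤ D.natAbs :=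
    Finset.sup_le fun k hk => hco k (by have := Finset.mem_range.1 hk; omega)
  unfold polyHeight
  generalize (Finset.range (g.natDegree + 1)).sup (fun k => (g.coeff k).natAbs) = s at hsup
  have e : |(D : ℝ)| = (D.natAbs : ℝ) := by
    rw [Nat.cast_natAbs]; simp
  have hD1 : 1 ≤ D.natAbs := by omega
  have hbl : Real.log (D.natAbs : ℝ) ≤ (d : ℝ) * (2 * h + Real.log ((d : ℝ) + 1)) := by
    rw [Real.log_le_iff_le_exp (by exact_mod_cast hD1), ← e]
    exact hb
  refine le_trans ?_ hbl
  rcases Nat.eq_zero_or_pos s with rfl | hs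
  · simpa using Real.log_natCast_nonneg D.natAbs
  · exact Real.log_le_log (by exact_mod_cast hs) (by exact_mod_cast hsup)
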